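/- Let n be a finite index type and let Σ : ℝ × ℝ → Matrix n n ℝ be such that Σ is twice continuously differentiable near (t₀,s₀) and Σ(t₀,s₀) is positive definite. Write Σ_t, Σ_s for the first partial derivatives at (t₀,s₀), Σ_{ts} for the mixed second partial derivative, and Σ^{(t)} = −Σ(t₀,s₀)⁻¹ * Σ_t * Σ(t₀,s₀)⁻¹. Then the mixed second partial derivative of (t,s) ↦ log (det Σ(t,s)) at (t₀,s₀) equals trace(Σ^{(t)} * Σ_s) + trace(Σ(t₀,s₀)⁻¹ * Σ_{ts}). -/

import Mathlib

open Matrix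

attribute [local instance] Matrix.normedAddCommGroup Matrix.normedSpace

section MatrixCalculus

variable {m n p : Type*} [Fintype n]

theorem Matrix.hasDerivAt_iff [Fintype m] {A : ℝ → Matrix m n ℝ} {A' : Matrix m n ℝ} {x : ℝ} :
    HasDerivAt A A' x ↔ ∀ i j, HasDerivAt (fun t => A t i j) (A' i j) x :=
  (hasDerivAt_pi (φ := A) (φ' := A')).trans (forall_congr' fun _ => hasDerivAt_pi)

theorem HasDerivAt.matrix_mul [Fintype m] [Fintype p] {A : ℝ → Matrix m n ℝ} {B : ℝ → Matrix n p ℝ}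
    {A' : Matrix m n ℝ} {B' : Matrix n p ℝ} {x : ℝ}
    (hA : HasDerivAt A A' x) (hB : HasDerivAt B B' x) :
    HasDerivAt (fun t => A t * B t) (A' * B x + A x * B') x := by
  rw [Matrix.hasDerivAt_iff] at *
  intro i j
  simp only [Matrix.add_apply, Matrix.mul_apply, ← Finset.sum_add_distrib]
  exact HasDerivAt.fun_sum fun k _ => (hA i k).mul (hB k j)

theorem HasDerivAt.matrix_trace {A : ℝ → Matrix n n ℝ} {A' : Matrix n n ℝ} {x : ℝ}
    (hA : HasDerivAt A A' x) : HasDerivAt (fun t => (A t).trace) A'.trace x := by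
  rw [Matrix.hasDerivAt_iff] at hA
  exact HasDerivAt.fun_sum fun i _ => hA i i

variable [DecidableEq n]

/-- Jacobi's formula for the derivative of a determinant. -/
theorem HasDerivAt.matrix_det {A : ℝ → Matrix n n ℝ} {A' : Matrix n n ℝ} {x : ℝ}
    (hA : HasDerivAt A A' x) :
    HasDerivAt (fun t => (A t).det) ((A x).adjugate * A').trace x := by
  rw [Matrix.hasDerivAt_iff] at hA
  have key : ((A x).adjugate * A').trace = ∑ σ : Equiv.Perm n, (Equiv.Perm.sign σ : ℝ) *
      ∑ i, (∏ j ∈ Finset.univ.erase i, A x (σ j) j) • A' (σ i) i := by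
    have h (i : n) : ((A x).adjugate * A') i i = ((A x).updateCol i (fun k => A' k i)).det := by
      rw [← Matrix.cramer_apply, Matrix.cramer_eq_adjugate_mulVec]
      rfl
    simp only [Matrix.trace, Matrix.diag_apply, h, Matrix.det_apply', Finset.mul_sum]
    rw [Finset.sum_comm]
    refine Finset.sum_congr rfl fun σ _ => Finset.sum_congr rfl fun i _ => ?_
    rw [← Finset.mul_prod_erase Finset.univ _ (Finset.mem_univ i), Matrix.updateCol_self,
      smul_eq_mul, mul_comm (A' (σ i) i)]
    congr 2
    exact Finset.prod_congr rfl fun j hj => Matrix.updateCol_ne (Finset.ne_of_mem_erase hj)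
  simp only [key, Matrix.det_apply']
  exact HasDerivAt.fun_sum fun σ _ =>
    (HasDerivAt.fun_finsetProd fun i _ => hA (σ i) i).const_mul _

theorem HasDerivAt.log_matrix_det {A : ℝ → Matrix n n ℝ} {A' : Matrix n n ℝ} {x : ℝ}
    (hA : HasDerivAt A A' x) (hdet : (A x).det ≠ 0) :
    HasDerivAt (fun t => Real.log (A t).det) ((A x)⁻¹ * A').trace x := by
  convert hA.matrix_det.log hdet using 1
  rw [Matrix.inv_def, Ring.inverse_eq_inv', Matrix.smul_mul, Matrix.trace_smul, smul_eq_mul,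
    div_eq_inv_mul]

theorem DifferentiableAt.matrix_inv {A : ℝ → Matrix n n ℝ} {x : ℝ}
    (hA : DifferentiableAt ℝ A x) (hdet : (A x).det ≠ 0) :
    DifferentiableAt ℝ (fun t => (A t)⁻¹) x := by
  have hentry := Matrix.hasDerivAt_iff.1 hA.hasDerivAt
  have hadj (i j : n) : DifferentiableAt ℝ (fun t => (A t).adjugate i j) x := by
    simp only [Matrix.adjugate_apply, Matrix.det_apply']
    refine DifferentiableAt.fun_sum fun σ _ => DifferentiableAt.const_mul ?_ _
    refine DifferentiableAt.fun_finsetProd fun k _ => ?_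
    by_cases h : σ k = j
    · simp [h]
    · simpa [Matrix.updateRow_ne h] using (hentry (σ k) k).differentiableAt
  refine (Matrix.hasDerivAt_iff (A' := Matrix.of fun i j =>
    deriv (fun t => (A t)⁻¹ i j) x)).2 (fun i j => ?_) |>.differentiableAt
  refine DifferentiableAt.hasDerivAt ?_
  simp only [Matrix.inv_def, Ring.inverse_eq_inv', Matrix.smul_apply, smul_eq_mul]
  exact (hA.hasDerivAt.matrix_det.differentiableAt.inv hdet).mul (hadj i j)

theorem HasDerivAt.matrix_inv {A : ℝ → Matrix n n ℝ} {A' : Matrix n n ℝ} {x : ℝ}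
    (hA : HasDerivAt A A' x) (hdet : (A x).det ≠ 0) :
    HasDerivAt (fun t => (A t)⁻¹) (-((A x)⁻¹ * A' * (A x)⁻¹)) x := by
  have hI := (hA.differentiableAt.matrix_inv hdet).hasDerivAt
  set I' := _root_.deriv (fun t => (A t)⁻¹) x
  have hone : (fun t => (A t)⁻¹ * A t) =ᶠ[nhds x] fun _ => 1 := by
    filter_upwards [hA.matrix_det.continuousAt.eventually_ne hdet] with t ht
    exact Matrix.nonsing_inv_mul _ ht.isUnit
  have hzero : I' * A x + (A x)⁻¹ * A' = 0 :=
    (hI.matrix_mul hA).unique ((hasDerivAt_const x (1 : Matrix n n ℝ)).congr_of_eventuallyEq hone)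
  have hI' : I' = -((A x)⁻¹ * A' * (A x)⁻¹) := by
    rw [← Matrix.neg_mul, ← eq_neg_of_add_eq_zero_left hzero,
      Matrix.mul_nonsing_inv_cancel_right _ _ hdet.isUnit]
  exact hI' ▸ hI

end MatrixCalculus

/-- Mixed second partial derivative of `log det Σ(t,s)`:
`∂² log det Σ / ∂t ∂s = tr(Σ^{(t)} Σ_s) + tr(Σ⁻¹ Σ_{ts})` with
`Σ^{(t)} = −Σ⁻¹ Σ_t Σ⁻¹`, the quantity `t_{(k)ii'}` in the observed information matrix. -/
theorem stmt_5 {n : Type*} [Fintype n] [DecidableEq n]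
    (S : ℝ × ℝ → Matrix n n ℝ) (t₀ s₀ : ℝ)
    (hS : ContDiffAt ℝ 2 S (t₀, s₀)) (hpd : (S (t₀, s₀)).PosDef)
    (St Ss Sts : Matrix n n ℝ)
    (hSt : St = deriv (fun t => S (t, s₀)) t₀)
    (hSs : Ss = deriv (fun s => S (t₀, s)) s₀)
    (hSts : Sts = deriv (fun t => deriv (fun s => S (t, s)) s₀) t₀) :
    deriv (fun t => deriv (fun s => Real.log (S (t, s)).det) s₀) t₀
      = (-((S (t₀, s₀))⁻¹ * St * (S (t₀, s₀))⁻¹) * Ss).trace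
        + ((S (t₀, s₀))⁻¹ * Sts).trace := by
  have hdet : (S (t₀, s₀)).det ≠ 0 := hpd.det_pos.ne'
  have hline : DifferentiableAt ℝ (fun t : ℝ => (t, s₀)) t₀ := by fun_prop
  have hSrow : DifferentiableAt ℝ (fun t => S (t, s₀)) t₀ :=
    (hS.differentiableAt (by norm_num)).comp t₀ hline
  have hev : ∀ᶠ t in nhds t₀, DifferentiableAt ℝ S (t, s₀) :=
    hline.continuousAt.eventually
      ((hS.eventually (by simp)).mono fun _ h => h.differentiableAt (by norm_num))
  have hcol {t : ℝ} (h : DifferentiableAt ℝ S (t, s₀)) :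
      HasDerivAt (fun s => S (t, s)) (fderiv ℝ S (t, s₀) (0, 1)) s₀ :=
    h.hasFDerivAt.comp_hasDerivAt s₀ ((hasDerivAt_const s₀ t).prodMk (hasDerivAt_id s₀))
  have hD : DifferentiableAt ℝ (fun t => deriv (fun s => S (t, s)) s₀) t₀ := by
    have hft : DifferentiableAt ℝ (fun t => fderiv ℝ S (t, s₀)) t₀ :=
      ((hS.fderiv_right (m := 1) (by norm_num)).comp t₀ (f := fun t : ℝ => (t, s₀))
        (by fun_prop)).differentiableAt (by norm_num)
    refine (hft.clm_apply (differentiableAt_const ((0, 1) : ℝ × ℝ))).congr_of_eventuallyEq ?_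
    filter_upwards [hev] with t ht using (hcol ht).deriv
  have hinner : (fun t => deriv (fun s => Real.log (S (t, s)).det) s₀) =ᶠ[nhds t₀]
      fun t => ((S (t, s₀))⁻¹ * deriv (fun s => S (t, s)) s₀).trace := by
    filter_upwards [hev, hSrow.hasDerivAt.matrix_det.continuousAt.eventually_ne hdet]
      with t ht hdt
    exact ((hcol ht).differentiableAt.hasDerivAt.log_matrix_det hdt).deriv
  rw [hinner.deriv_eq,
    ((hSrow.hasDerivAt.matrix_inv hdet).matrix_mul hD.hasDerivAt).matrix_trace.deriv,
    Matrix.trace_add, hSt, hSs, hSts]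
  rfl
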